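/- Let a, b be nonzero real numbers with a³ ≠ b³, let k ≥ 0 be an integer, and set θ = 2π/3, δ = π/3. Then ∫₀^∞ t (log t)^k · [ 1/((t² + a t + a²)(t² + b t + b²)) + 1/((t² − a t + a²)(t² − b t + b²)) ] dt = (θ^{k+1}(a+b)/(a³−b³)) [R_k(log|a|/θ) − R_k(log|b|/θ)] + (θ^{k+1}/(√3(a²+ab+b²))) [S_k(log|a|/θ) + S_k(log|b|/θ)] + (δ^{k+1}(a+b)/(a³−b³)) [P_k(log|a|/δ) − P_k(log|b|/δ)] + (δ^{k+1}/(√3(a²+ab+b²))) [Q_k(log|a|/δ) + Q_k(log|b|/δ)]. -/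

import Mathlib

open Finset

/-- Non-recursive part of `Rpoly`. -/
noncomputable def GR (k : ℕ) : Polynomial ℝ :=
  Polynomial.C ((1 : ℝ) / (2 * (k + 1))) *
    ∑ j ∈ (Finset.range (k + 2)).filter (fun j => Even j),
      Polynomial.C ((-1 : ℝ) ^ (j / 2) * ((k + 1).choose j : ℝ) * ((2 : ℝ) ^ j + 1)) *
        Polynomial.X ^ (k + 1 - j)

noncomputable def GS (k : ℕ) : Polynomial ℝ :=
  Polynomial.C ((1 : ℝ) / (2 * (k + 1))) *
    ∑ j ∈ (Finset.range (k + 2)).filter (fun j => Odd j),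
      Polynomial.C ((-1 : ℝ) ^ ((j + 1) / 2) * ((k + 1).choose j : ℝ) * ((2 : ℝ) ^ j - 1)) *
        Polynomial.X ^ (k + 1 - j)

noncomputable def GP (k : ℕ) : Polynomial ℝ :=
  Polynomial.C ((1 : ℝ) / (2 * (k + 1))) *
    ∑ j ∈ (Finset.range (k + 2)).filter (fun j => Even j),
      Polynomial.C ((-1 : ℝ) ^ (j / 2) * ((k + 1).choose j : ℝ) * ((5 : ℝ) ^ j + 1)) *
        Polynomial.X ^ (k + 1 - j)

noncomputable def GQ (k : ℕ) : Polynomial ℝ :=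
  Polynomial.C ((1 : ℝ) / (2 * (k + 1))) *
    ∑ j ∈ (Finset.range (k + 2)).filter (fun j => Odd j),
      Polynomial.C ((-1 : ℝ) ^ ((j - 1) / 2) * ((k + 1).choose j : ℝ) * ((5 : ℝ) ^ j - 1)) *
        Polynomial.X ^ (k + 1 - j)

noncomputable def GY (k : ℕ) : Polynomial ℝ :=
  Polynomial.C (-((1 : ℝ) / (k + 1))) *
    (Polynomial.X ^ (k + 1) +
      ∑ j ∈ (Finset.range (k + 2)).filter (fun j => Even j),
        Polynomial.C ((-1 : ℝ) ^ (j / 2) * ((k + 1).choose j : ℝ) * ((3 : ℝ) ^ j)) *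
          Polynomial.X ^ (k + 1 - j))

noncomputable def GZ (k : ℕ) : Polynomial ℝ :=
  Polynomial.C (-((2 : ℝ) / (k + 1))) *
    ∑ j ∈ (Finset.range (k + 2)).filter (fun j => Even j),
      Polynomial.C ((-1 : ℝ) ^ (j / 2) * ((k + 1).choose j : ℝ) * ((3 : ℝ) ^ j)) *
        Polynomial.X ^ (k + 1 - j)

/-- The common recursion: `F k = (1/(k+1)) ∑_{3 ≤ j ≤ k+1, j odd}
(−1)^{(j+1)/2} C(k+1,j) m^{j−1} F_{k+1−j} + G k`. -/
noncomputable def recFam (m : ℝ) (G : ℕ → Polynomial ℝ) : ℕ → Polynomial ℝ := fun k =>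
  Nat.strongRecOn k fun k ih =>
    Polynomial.C ((1 : ℝ) / (k + 1)) *
      (∑ j ∈ ((Finset.range (k + 2)).filter (fun j => Odd j ∧ 3 ≤ j)).attach,
        Polynomial.C ((-1 : ℝ) ^ ((j.1 + 1) / 2) * ((k + 1).choose j.1 : ℝ) * m ^ (j.1 - 1)) *
          ih (k + 1 - j.1) (by
            have hj := j.2
            simp only [Finset.mem_filter, Finset.mem_range] at hj
            omega))
    + G k

noncomputable def Rpoly : ℕ → Polynomial ℝ := recFam 3 GR
noncomputable def Spoly : ℕ → Polynomial ℝ := recFam 3 GS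
noncomputable def Ppoly : ℕ → Polynomial ℝ := recFam 6 GP
noncomputable def Qpoly : ℕ → Polynomial ℝ := recFam 6 GQ
noncomputable def Ypoly : ℕ → Polynomial ℝ := recFam 3 GY
noncomputable def Zpoly : ℕ → Polynomial ℝ := recFam 6 GZ

open MeasureTheory

/-- The Gamma integral with a complex rate `z` in the right half-plane. -/
theorem integral_rpow_mul_cexp_neg_mul_Ioi {r : ℝ} (hr : 0 < r) {z : ℂ} (hz : 0 < z.re) :
    ∫ x in Set.Ioi (0 : ℝ), ((x ^ (r - 1) : ℝ) : ℂ) * Complex.exp (-(z * x)) =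
      z ^ (-(r : ℂ)) * Real.Gamma r := by
  have hmeas : Measurable fun x : ℝ => ENNReal.ofReal (x ^ (r - 1)) := by fun_prop
  set μ : Measure ℝ :=
    (volume.restrict (Set.Ioi 0)).withDensity fun x => ENNReal.ofReal (x ^ (r - 1)) with hμ
  have hmgf (w : ℂ) : ProbabilityTheory.complexMGF (fun x : ℝ => -x) μ w =
      ∫ x in Set.Ioi (0 : ℝ), ((x ^ (r - 1) : ℝ) : ℂ) * Complex.exp (-(w * x)) := by
    rw [ProbabilityTheory.complexMGF, hμ,
      integral_withDensity_eq_integral_toReal_smul hmeas (by simp)]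
    refine setIntegral_congr_fun measurableSet_Ioi fun x hx => ?_
    have hx' : (0 : ℝ) ≤ x ^ (r - 1) := Real.rpow_nonneg (le_of_lt hx) _
    simp [ENNReal.toReal_ofReal hx']
  have hset : Set.Ioi (0 : ℝ) ⊆ interior (ProbabilityTheory.integrableExpSet (fun x => -x) μ) := by
    refine interior_maximal (fun t ht => ?_) isOpen_Ioi
    rw [ProbabilityTheory.integrableExpSet, Set.mem_ofPred_eq, hμ,
      integrable_withDensity_iff_integrable_smul' hmeas (by simp)]
    have h := integrableOn_rpow_mul_exp_neg_mul_rpow (s := r - 1) (p := 1) (by linarith)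
      one_pos (show 0 < t from ht)
    refine IntegrableOn.congr_fun h (fun x hx => ?_) measurableSet_Ioi
    have hx' : (0 : ℝ) ≤ x ^ (r - 1) := Real.rpow_nonneg (le_of_lt hx) _
    simp [ENNReal.toReal_ofReal hx']
  have hreal (t : ℝ) (ht : 0 < t) : ProbabilityTheory.complexMGF (fun x : ℝ => -x) μ t =
      (t : ℂ) ^ (-(r : ℂ)) * Real.Gamma r := by
    have h := Real.integral_rpow_mul_exp_neg_mul_Ioi hr ht
    rw [one_div, Real.inv_rpow ht.le, ← Real.rpow_neg ht.le] at h
    rw [hmgf, ← Complex.ofReal_neg, ← Complex.ofReal_cpow ht.le, ← Complex.ofReal_mul, ← h,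
      ← integral_complex_ofReal]
    simp
  have hU : IsPreconnected {w : ℂ | 0 < w.re} := (convex_halfSpace_re_gt 0).isPreconnected
  have hf : AnalyticOnNhd ℂ (ProbabilityTheory.complexMGF (fun x : ℝ => -x) μ)
      {w : ℂ | 0 < w.re} :=
    ProbabilityTheory.analyticOnNhd_complexMGF.mono fun w hw => hset hw
  have hg : AnalyticOnNhd ℂ (fun w : ℂ => w ^ (-(r : ℂ)) * Real.Gamma r) {w : ℂ | 0 < w.re} := by
    intro w hw
    exact (analyticAt_id.cpow analyticAt_const (Or.inl hw)).mul analyticAt_const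
  have hfreq : ∃ᶠ w in nhdsWithin (1 : ℂ) {1}ᶜ,
      ProbabilityTheory.complexMGF (fun x : ℝ => -x) μ w = w ^ (-(r : ℂ)) * Real.Gamma r := by
    have htend : Filter.Tendsto (fun t : ℝ => (t : ℂ)) (nhdsWithin 1 {1}ᶜ)
        (nhdsWithin (1 : ℂ) {1}ᶜ) := by
      refine tendsto_nhdsWithin_of_tendsto_nhds_of_eventually_within _ ?_ ?_
      · exact (Complex.continuous_ofReal.tendsto' 1 1 (by simp)).mono_left nhdsWithin_le_nhds
      · filter_upwards [self_mem_nhdsWithin] with t ht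
        simpa using ht
    refine htend.frequently (Filter.Eventually.frequently ?_)
    filter_upwards [nhdsWithin_le_nhds (Ioi_mem_nhds (zero_lt_one (α := ℝ)))] with t ht
      using hreal t ht
  rw [← hmgf]
  exact hf.eqOn_of_preconnected_of_frequently_eq hg hU (by simp) hfreq hz

/-- The Mellin transform of `t ↦ (t + z)⁻¹` for `z` in the right half-plane. -/
theorem integral_rpow_div_add_Ioi {r : ℝ} (hr : 0 < r) (hr1 : r < 1) {z : ℂ} (hz : 0 < z.re) :
    IntegrableOn (fun t : ℝ => ((t ^ (r - 1) : ℝ) : ℂ) / (t + z)) (Set.Ioi 0) ∧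
    ∫ t in Set.Ioi (0 : ℝ), ((t ^ (r - 1) : ℝ) : ℂ) / (t + z) =
      Real.pi / Real.sin (Real.pi * r) * z ^ ((r : ℂ) - 1) := by
  set f : ℝ → ℝ → ℂ := fun t x => ((t ^ (r - 1) : ℝ) : ℂ) * Complex.exp (-((t + z) * x)) with hf
  have hinner (t : ℝ) (ht : 0 < t) :
      ∫ x in Set.Ioi (0 : ℝ), f t x = ((t ^ (r - 1) : ℝ) : ℂ) / (t + z) := by
    have hre : 0 < ((t : ℂ) + z).re := by simp; linarith
    have := integral_rpow_mul_cexp_neg_mul_Ioi one_pos hre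
    simp only [sub_self, Real.rpow_zero, Complex.ofReal_one, one_mul, Real.Gamma_one,
      mul_one, Complex.cpow_neg_one] at this
    simp only [hf]
    rw [integral_const_mul, this, div_eq_mul_inv]
  have houter (x : ℝ) (hx : 0 < x) : ∫ t in Set.Ioi (0 : ℝ), f t x =
      Real.Gamma r * (((x ^ ((1 - r) - 1) : ℝ) : ℂ) * Complex.exp (-(z * x))) := by
    have h := Real.integral_rpow_mul_exp_neg_mul_Ioi hr hx
    rw [one_div, Real.inv_rpow hx.le, ← Real.rpow_neg hx.le] at h
    rw [show (1 - r) - 1 = -r by ring, mul_left_comm, ← mul_assoc, ← Complex.ofReal_mul, ← h,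
      ← integral_complex_ofReal, ← integral_mul_const]
    refine setIntegral_congr_fun measurableSet_Ioi fun t _ => ?_
    simp only [hf, Complex.ofReal_mul, Complex.ofReal_exp, mul_assoc, ← Complex.exp_add]
    congr 2
    push_cast
    ring
  have hnorm (t x : ℝ) (ht : 0 < t) :
      ‖f t x‖ = t ^ (r - 1) * Real.exp (-(x * t)) * Real.exp (-(z.re * x)) := by
    rw [hf, norm_mul, Complex.norm_real, Complex.norm_exp,
      Real.norm_of_nonneg (Real.rpow_nonneg ht.le _), mul_assoc, ← Real.exp_add]
    congr 2
    simp
    ring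
  have hInt : Integrable (Function.uncurry f)
      ((volume.restrict (Set.Ioi 0)).prod (volume.restrict (Set.Ioi 0))) := by
    rw [integrable_prod_iff' (by
      apply Measurable.aestronglyMeasurable
      simp only [hf, Function.uncurry_def]
      fun_prop)]
    have h (x : ℝ) (hx : 0 < x) :
        IntegrableOn (fun t : ℝ => t ^ (r - 1) * Real.exp (-(x * t))) (Set.Ioi 0) := by
      have := integrableOn_rpow_mul_exp_neg_mul_rpow (s := r - 1) (p := 1) (by linarith)
        one_pos hx
      simpa using this
    constructor
    · filter_upwards [ae_restrict_mem measurableSet_Ioi] with x hx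
      refine ((integrable_norm_iff (by
        apply Measurable.aestronglyMeasurable
        simp only [hf, Function.uncurry_def]
        fun_prop)).1 ?_)
      refine IntegrableOn.congr_fun ((h x hx).mul_const (Real.exp (-(z.re * x))))
        (fun t ht => (hnorm t x ht).symm) measurableSet_Ioi
    · have h2 := integrableOn_rpow_mul_exp_neg_mul_rpow (s := -r) (p := 1) (by linarith)
        one_pos hz
      refine IntegrableOn.congr_fun (h2.const_mul (Real.Gamma r)) (fun x hx => ?_) measurableSet_Ioi
      have hx' : (0 : ℝ) < x := hx
      have e : ∫ t in Set.Ioi (0 : ℝ), ‖f t x‖ =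
          (∫ t in Set.Ioi (0 : ℝ), t ^ (r - 1) * Real.exp (-(x * t))) *
            Real.exp (-(z.re * x)) := by
        rw [← integral_mul_const]
        exact setIntegral_congr_fun measurableSet_Ioi fun t ht => hnorm t x ht
      simp only [Function.uncurry_apply_pair]
      rw [e, Real.integral_rpow_mul_exp_neg_mul_Ioi hr hx', one_div, Real.inv_rpow hx'.le,
        ← Real.rpow_neg hx'.le]
      simp
      ring
  constructor
  · exact IntegrableOn.congr_fun hInt.integral_prod_left (fun t ht => hinner t ht)
      measurableSet_Ioi
  · rw [← setIntegral_congr_fun measurableSet_Ioi fun t ht => hinner t ht,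
      integral_integral_swap hInt, setIntegral_congr_fun measurableSet_Ioi fun x hx => houter x hx,
      integral_const_mul, integral_rpow_mul_cexp_neg_mul_Ioi (by linarith) hz, mul_left_comm,
      ← Complex.ofReal_mul, Real.Gamma_mul_Gamma_one_sub, mul_comm]
    push_cast
    ring_nf

theorem integral_rpow_mul_linear_div_quadratic_Ioi {r c : ℝ} (hr : 0 < r) (hr1 : r < 1)
    (hc : 0 < c) (p q : ℝ) :
    IntegrableOn (fun u : ℝ => u ^ (r - 1) *
      ((p * (u + c / 2) + q * (c * √3 / 2)) / (u ^ 2 + c * u + c ^ 2))) (Set.Ioi 0) ∧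
    ∫ u in Set.Ioi (0 : ℝ), u ^ (r - 1) *
        ((p * (u + c / 2) + q * (c * √3 / 2)) / (u ^ 2 + c * u + c ^ 2)) =
      Real.pi / Real.sin (Real.pi * r) * c ^ (r - 1) *
        (p * Real.cos (Real.pi * (r - 1) / 3) - q * Real.sin (Real.pi * (r - 1) / 3)) := by
  have h3 : √3 * √3 = (3 : ℝ) := Real.mul_self_sqrt (by norm_num)
  set z : ℂ := c * Complex.exp ((Real.pi / 3 : ℝ) * Complex.I) with hz
  have hzre : z.re = c / 2 := by
    rw [hz, Complex.re_ofReal_mul, Complex.exp_ofReal_mul_I_re, Real.cos_pi_div_three]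
    ring
  have hzim : z.im = c * √3 / 2 := by
    rw [hz, Complex.im_ofReal_mul, Complex.exp_ofReal_mul_I_im, Real.sin_pi_div_three]
    ring
  obtain ⟨hint, hval⟩ := integral_rpow_div_add_Ioi hr hr1 (z := z) (by rw [hzre]; positivity)
  have hpt (u : ℝ) : (((p : ℂ) + q * Complex.I) * (((u ^ (r - 1) : ℝ) : ℂ) / (u + z))).re =
      u ^ (r - 1) * ((p * (u + c / 2) + q * (c * √3 / 2)) / (u ^ 2 + c * u + c ^ 2)) := by
    have hn : Complex.normSq (u + z) = u ^ 2 + c * u + c ^ 2 := by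
      rw [Complex.normSq_apply]
      simp only [Complex.add_re, Complex.add_im, Complex.ofReal_re, Complex.ofReal_im, hzre, hzim]
      linear_combination c ^ 2 / 4 * h3
    rw [div_eq_mul_inv, mul_left_comm, Complex.re_ofReal_mul, Complex.mul_re, Complex.inv_re,
      Complex.inv_im, hn]
    simp only [Complex.add_re, Complex.add_im, Complex.mul_re, Complex.mul_im, Complex.ofReal_re,
      Complex.ofReal_im, Complex.I_re, Complex.I_im, hzre, hzim]
    ring
  have hcpow : z ^ ((r : ℂ) - 1) = ((c ^ (r - 1) : ℝ) : ℂ) *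
      Complex.exp ((Real.pi * (r - 1) / 3 : ℝ) * Complex.I) := by
    have hpi := Real.pi_pos
    have hexp : Complex.exp ((Real.pi / 3 : ℝ) * Complex.I) ≠ 0 := Complex.exp_ne_zero _
    rw [Complex.cpow_def_of_ne_zero (mul_ne_zero (by exact_mod_cast hc.ne') hexp),
      Complex.log_ofReal_mul hc hexp, Complex.log_exp (by simp; linarith) (by simp; linarith),
      Real.rpow_def_of_pos hc, Complex.ofReal_exp, ← Complex.exp_add]
    congr 1
    push_cast
    ring
  have hint' := hint.const_mul ((p : ℂ) + q * Complex.I)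
  constructor
  · refine IntegrableOn.congr_fun hint'.re (fun u _ => ?_) measurableSet_Ioi
    exact hpt u
  · rw [← setIntegral_congr_fun measurableSet_Ioi fun u _ => hpt u]
    have := integral_re hint'
    simp only [RCLike.re_to_complex] at this
    rw [this, integral_const_mul, hval, hcpow]
    rw [show ∀ x : ℂ, ((p : ℂ) + q * Complex.I) * ((Real.pi : ℂ) / (Real.sin (Real.pi * r) : ℝ) *
      (((c ^ (r - 1) : ℝ) : ℂ) * x)) = ((Real.pi / Real.sin (Real.pi * r) * c ^ (r - 1) : ℝ) : ℂ) *
        (((p : ℂ) + q * Complex.I) * x) from fun x => by push_cast; ring,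
      Complex.re_ofReal_mul, Complex.mul_re, Complex.exp_ofReal_mul_I_re,
      Complex.exp_ofReal_mul_I_im]
    simp

theorem quadratic_pos {a : ℝ} (ha : a ≠ 0) (t : ℝ) : 0 < t ^ 2 + a * t + a ^ 2 := by
  have : 0 < a ^ 2 := by positivity
  nlinarith [sq_nonneg (2 * t + a)]

theorem quadratic_pos' {a : ℝ} (ha : a ≠ 0) (t : ℝ) : 0 < t ^ 2 - a * t + a ^ 2 := by
  have := quadratic_pos (neg_ne_zero.2 ha) t
  linarith [neg_sq a]

/-- The weight against which powers of `log` are integrated. -/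
noncomputable def quarticWeight (a b t : ℝ) : ℝ :=
  1 / ((t ^ 2 + a * t + a ^ 2) * (t ^ 2 + b * t + b ^ 2))
    + 1 / ((t ^ 2 - a * t + a ^ 2) * (t ^ 2 - b * t + b ^ 2))

theorem quarticWeight_nonneg {a b : ℝ} (ha : a ≠ 0) (hb : b ≠ 0) (t : ℝ) :
    0 ≤ quarticWeight a b t := by
  have h1 := quadratic_pos ha t
  have h2 := quadratic_pos hb t
  have h3 := quadratic_pos' ha t
  have h4 := quadratic_pos' hb t
  unfold quarticWeight
  positivity

theorem quarticWeight_eq {a b : ℝ} (ha : a ≠ 0) (hb : b ≠ 0) (hab : a ^ 3 ≠ b ^ 3) (t : ℝ) :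
    quarticWeight a b t =
      2 * ((-((a + b) / (a ^ 3 - b ^ 3)) * (t ^ 2 + a ^ 2 / 2)
            + 1 / (√3 * (a ^ 2 + a * b + b ^ 2)) * (a ^ 2 * √3 / 2))
            / ((t ^ 2) ^ 2 + a ^ 2 * t ^ 2 + (a ^ 2) ^ 2)
        + ((a + b) / (a ^ 3 - b ^ 3) * (t ^ 2 + b ^ 2 / 2)
            + 1 / (√3 * (a ^ 2 + a * b + b ^ 2)) * (b ^ 2 * √3 / 2))
            / ((t ^ 2) ^ 2 + b ^ 2 * t ^ 2 + (b ^ 2) ^ 2)) := by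
  have hs : √3 ≠ (0 : ℝ) := by positivity
  have h1 := (quadratic_pos ha t).ne'
  have h2 := (quadratic_pos hb t).ne'
  have h3 := (quadratic_pos' ha t).ne'
  have h4 := (quadratic_pos' hb t).ne'
  have hN : a ^ 2 + a * b + b ^ 2 ≠ 0 := by
    have := (quadratic_pos hb a).ne'
    rwa [mul_comm b a] at this
  have hd : a - b ≠ 0 := fun h => hab (by rw [sub_eq_zero.1 h])
  have hcancel (x : ℝ) : 1 / (√3 * (a ^ 2 + a * b + b ^ 2)) * (x ^ 2 * √3 / 2) =
      x ^ 2 / (2 * (a ^ 2 + a * b + b ^ 2)) := by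
    field_simp
  have hfac (x : ℝ) : (t ^ 2) ^ 2 + x ^ 2 * t ^ 2 + (x ^ 2) ^ 2 =
      (t ^ 2 + x * t + x ^ 2) * (t ^ 2 - x * t + x ^ 2) := by ring
  rw [quarticWeight, hcancel, hcancel, hfac, hfac,
    show a ^ 3 - b ^ 3 = (a - b) * (a ^ 2 + a * b + b ^ 2) by ring]
  generalize hA : t ^ 2 + a * t + a ^ 2 = A at *
  generalize hB : t ^ 2 + b * t + b ^ 2 = B at *
  generalize hC : t ^ 2 - a * t + a ^ 2 = C at *
  generalize hD : t ^ 2 - b * t + b ^ 2 = D at *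
  generalize hM : a ^ 2 + a * b + b ^ 2 = M at *
  field_simp
  subst hA hB hC hD hM
  ring

theorem integral_rpow_mul_quarticWeight {a b : ℝ} (ha : a ≠ 0) (hb : b ≠ 0)
    (hab : a ^ 3 ≠ b ^ 3) {s : ℝ} (hs : -2 < s) (hs0 : s < 0) :
    ∫ t in Set.Ioi (0 : ℝ), t ^ s * (t * quarticWeight a b t) =
      Real.pi / Real.sin (Real.pi * s / 2) *
        ((a + b) / (a ^ 3 - b ^ 3) * (Real.cos (Real.pi * s / 6) *
            (Real.exp (Real.log |a| * s) - Real.exp (Real.log |b| * s)))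
          + 1 / (√3 * (a ^ 2 + a * b + b ^ 2)) * (Real.sin (Real.pi * s / 6) *
            (Real.exp (Real.log |a| * s) + Real.exp (Real.log |b| * s)))) := by
  have hr : 0 < s / 2 + 1 := by linarith
  have hr1 : s / 2 + 1 < 1 := by linarith
  set c₁ := (a + b) / (a ^ 3 - b ^ 3) with hc₁
  set c₂ := 1 / (√3 * (a ^ 2 + a * b + b ^ 2)) with hc₂
  obtain ⟨ia, va⟩ := integral_rpow_mul_linear_div_quadratic_Ioi hr hr1
    (show 0 < a ^ 2 by positivity) (-c₁) c₂
  obtain ⟨ib, vb⟩ := integral_rpow_mul_linear_div_quadratic_Ioi hr hr1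
    (show 0 < b ^ 2 by positivity) c₁ c₂
  have hsub := integral_comp_rpow_Ioi_of_pos (g := fun u : ℝ =>
    u ^ (s / 2 + 1 - 1) *
      ((-c₁ * (u + a ^ 2 / 2) + c₂ * (a ^ 2 * √3 / 2)) / (u ^ 2 + a ^ 2 * u + (a ^ 2) ^ 2)) +
    u ^ (s / 2 + 1 - 1) *
      ((c₁ * (u + b ^ 2 / 2) + c₂ * (b ^ 2 * √3 / 2)) / (u ^ 2 + b ^ 2 * u + (b ^ 2) ^ 2)))
    two_pos
  rw [integral_add ia ib, va, vb] at hsub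
  have hsin : Real.sin (Real.pi * (s / 2 + 1)) = -Real.sin (Real.pi * s / 2) := by
    rw [← Real.sin_add_pi]
    ring_nf
  have hpow {x : ℝ} (hx : x ≠ 0) : (x ^ 2) ^ (s / 2 + 1 - 1) = Real.exp (Real.log |x| * s) := by
    rw [Real.rpow_def_of_pos (by positivity), Real.log_pow, Real.log_abs]
    congr 1
    push_cast
    ring
  rw [hsin, hpow ha, hpow hb, show Real.pi * (s / 2 + 1 - 1) / 3 = Real.pi * s / 6 by ring] at hsub
  rw [setIntegral_congr_fun measurableSet_Ioi (g := fun x : ℝ => (2 * x ^ ((2 : ℝ) - 1)) •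
    ((x ^ (2 : ℝ)) ^ (s / 2 + 1 - 1) *
      ((-c₁ * (x ^ (2 : ℝ) + a ^ 2 / 2) + c₂ * (a ^ 2 * √3 / 2)) /
        ((x ^ (2 : ℝ)) ^ 2 + a ^ 2 * x ^ (2 : ℝ) + (a ^ 2) ^ 2)) +
    (x ^ (2 : ℝ)) ^ (s / 2 + 1 - 1) *
      ((c₁ * (x ^ (2 : ℝ) + b ^ 2 / 2) + c₂ * (b ^ 2 * √3 / 2)) /
        ((x ^ (2 : ℝ)) ^ 2 + b ^ 2 * x ^ (2 : ℝ) + (b ^ 2) ^ 2)))) ?_, hsub]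
  · rw [div_neg]
    ring
  · intro t ht
    have ht' : (0 : ℝ) < t := ht
    have h2 : (t ^ 2) ^ (s / 2 + 1 - 1) = t ^ s := by
      rw [← Real.rpow_two, ← Real.rpow_mul ht'.le]
      ring_nf
    have hw := quarticWeight_eq ha hb hab t
    rw [← hc₁, ← hc₂] at hw
    simp only [Real.rpow_two, h2, show (2 : ℝ) - 1 = 1 by norm_num, Real.rpow_one, smul_eq_mul, hw]
    ring

theorem integrableOn_rpow_mul_quarticWeight {a b : ℝ} (ha : a ≠ 0) (hb : b ≠ 0)
    {s : ℝ} (hs : -1 < s) (hs1 : s < 1) :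
    IntegrableOn (fun t => t ^ s * (t * quarticWeight a b t)) (Set.Ioi 0) := by
  have hcont : Continuous fun t => t * quarticWeight a b t := by
    unfold quarticWeight
    have h1 (t : ℝ) := mul_pos (quadratic_pos ha t) (quadratic_pos hb t)
    have h2 (t : ℝ) := mul_pos (quadratic_pos' ha t) (quadratic_pos' hb t)
    fun_prop (disch := intro t; first | exact (h1 t).ne' | exact (h2 t).ne')
  have hbot : (fun t => t * quarticWeight a b t) =O[nhdsWithin 0 (Set.Ioi 0)]
      fun t : ℝ => t ^ (-(0 : ℝ)) := by
    simp only [neg_zero, Real.rpow_zero]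
    exact (hcont.tendsto 0).isBigO_one ℝ |>.mono nhdsWithin_le_nhds
  have htop : (fun t => t * quarticWeight a b t) =O[Filter.atTop]
      fun t : ℝ => t ^ (-(3 : ℝ)) := by
    refine Asymptotics.IsBigO.of_bound (32 / 9) ?_
    filter_upwards [Filter.eventually_gt_atTop 0] with t ht
    have hq {x : ℝ} : 3 / 4 * t ^ 2 ≤ t ^ 2 + x * t + x ^ 2 := by
      nlinarith [sq_nonneg (t + 2 * x)]
    have hq' {x : ℝ} : 3 / 4 * t ^ 2 ≤ t ^ 2 - x * t + x ^ 2 := by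
      nlinarith [sq_nonneg (t - 2 * x)]
    have hp : 0 < 3 / 4 * t ^ 2 := by positivity
    rw [Real.norm_of_nonneg (mul_nonneg ht.le (quarticWeight_nonneg ha hb t)),
      Real.norm_of_nonneg (by positivity), Real.rpow_neg ht.le,
      show (3 : ℝ) = (3 : ℕ) by norm_num, Real.rpow_natCast]
    calc t * quarticWeight a b t
        ≤ t * (1 / ((3 / 4 * t ^ 2) * (3 / 4 * t ^ 2)) +
            1 / ((3 / 4 * t ^ 2) * (3 / 4 * t ^ 2))) := by
          unfold quarticWeight
          gcongr <;> first | exact hq | exact hq' | exact (hp.trans_le hq).le |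
            exact (hp.trans_le hq').le
      _ = _ := by
          field_simp
          norm_num
  have := mellin_convergent_of_isBigO_scalar (s := s + 1)
    (hcont.locallyIntegrable.locallyIntegrableOn _) htop (by linarith) hbot (by linarith)
  simpa using this

/-- The `n`-th Taylor coefficient at `0`, in exponential form, of `sin (ω x)` times the series with
coefficients `F`. -/
noncomputable def oddConv (ω : ℝ) (F : ℕ → ℝ) (n : ℕ) : ℝ :=
  ∑ j ∈ (Finset.range (n + 1)).filter (fun j => Odd j),
    (-1 : ℝ) ^ ((j - 1) / 2) * (n.choose j : ℝ) * ω ^ j * F (n - j)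

/-- The `n`-th Taylor coefficient at `0`, in exponential form, of `cos (ω x)` times the series with
coefficients `F`. -/
noncomputable def evenConv (ω : ℝ) (F : ℕ → ℝ) (n : ℕ) : ℝ :=
  ∑ j ∈ (Finset.range (n + 1)).filter (fun j => Even j),
    (-1 : ℝ) ^ (j / 2) * (n.choose j : ℝ) * ω ^ j * F (n - j)

theorem iteratedDeriv_sin_mul_zero (ω : ℝ) {f : ℝ → ℝ} (n : ℕ) (hf : ContDiffAt ℝ n f 0) :
    iteratedDeriv n (fun s => Real.sin (ω * s) * f s) 0 =
      oddConv ω (fun i => iteratedDeriv i f 0) n := by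
  rw [iteratedDeriv_fun_mul (by fun_prop) hf, oddConv, Finset.sum_filter]
  refine Finset.sum_congr rfl fun j _ => ?_
  rw [iteratedDeriv_comp_const_mul Real.contDiff_sin]
  rcases Nat.even_or_odd' j with ⟨i, rfl | rfl⟩
  · rw [Real.iteratedDeriv_even_sin]
    simp
  · rw [Real.iteratedDeriv_odd_sin]
    simp
    left
    ring

theorem iteratedDeriv_cos_mul_zero (ω : ℝ) {f : ℝ → ℝ} (n : ℕ) (hf : ContDiffAt ℝ n f 0) :
    iteratedDeriv n (fun s => Real.cos (ω * s) * f s) 0 =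
      evenConv ω (fun i => iteratedDeriv i f 0) n := by
  rw [iteratedDeriv_fun_mul (by fun_prop) hf, evenConv, Finset.sum_filter]
  refine Finset.sum_congr rfl fun j _ => ?_
  rw [iteratedDeriv_comp_const_mul Real.contDiff_cos]
  rcases Nat.even_or_odd' j with ⟨i, rfl | rfl⟩
  · rw [Real.iteratedDeriv_even_cos]
    simp
    left
    ring
  · rw [Real.iteratedDeriv_odd_cos]
    simp

theorem oddConv_add (ω : ℝ) (F F' : ℕ → ℝ) (n : ℕ) :
    oddConv ω (fun i => F i + F' i) n = oddConv ω F n + oddConv ω F' n := by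
  simp only [oddConv, mul_add, Finset.sum_add_distrib]

theorem oddConv_sub (ω : ℝ) (F F' : ℕ → ℝ) (n : ℕ) :
    oddConv ω (fun i => F i - F' i) n = oddConv ω F n - oddConv ω F' n := by
  simp only [oddConv, mul_sub, Finset.sum_sub_distrib]

theorem oddConv_const_mul (ω c : ℝ) (F : ℕ → ℝ) (n : ℕ) :
    oddConv ω (fun i => c * F i) n = c * oddConv ω F n := by
  simp only [oddConv, Finset.mul_sum]
  exact Finset.sum_congr rfl fun j _ => by ring

theorem filter_odd_range (k : ℕ) :
    (Finset.range (k + 2)).filter (fun j => Odd j) =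
      insert 1 ((Finset.range (k + 2)).filter fun j => Odd j ∧ 3 ≤ j) := by
  ext j
  simp only [Finset.mem_filter, Finset.mem_range, Finset.mem_insert]
  constructor
  · rintro ⟨h, i, rfl⟩
    by_cases hi : i = 0
    · simp [hi]
    · exact Or.inr ⟨h, ⟨i, rfl⟩, by omega⟩
  · rintro (rfl | ⟨h, h', -⟩)
    · exact ⟨by omega, odd_one⟩
    · exact ⟨h, h'⟩

theorem oddConv_succ (ω : ℝ) (F : ℕ → ℝ) (k : ℕ) :
    oddConv ω F (k + 1) = (k + 1) * ω * F k +
      ∑ j ∈ (Finset.range (k + 2)).filter (fun j => Odd j ∧ 3 ≤ j),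
        (-1 : ℝ) ^ ((j - 1) / 2) * ((k + 1).choose j : ℝ) * ω ^ j * F (k + 1 - j) := by
  rw [oddConv, filter_odd_range, Finset.sum_insert (by simp)]
  simp

theorem oddConv_injective {ω : ℝ} (hω : ω ≠ 0) {F F' : ℕ → ℝ}
    (h : ∀ k, oddConv ω F (k + 1) = oddConv ω F' (k + 1)) (k : ℕ) : F k = F' k := by
  induction k using Nat.strongRecOn with
  | ind k ih =>
    have hk := h k
    rw [oddConv_succ, oddConv_succ, Finset.sum_congr rfl fun j hj => by
      rw [ih (k + 1 - j) (by simp only [Finset.mem_filter, Finset.mem_range] at hj; omega)],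
      add_left_inj] at hk
    exact mul_left_cancel₀ (mul_ne_zero (by positivity) hω) hk

theorem recFam_eq (m : ℝ) (G : ℕ → Polynomial ℝ) (k : ℕ) :
    recFam m G k = Polynomial.C ((1 : ℝ) / (k + 1)) *
      (∑ j ∈ (Finset.range (k + 2)).filter (fun j => Odd j ∧ 3 ≤ j),
        Polynomial.C ((-1 : ℝ) ^ ((j + 1) / 2) * ((k + 1).choose j : ℝ) * m ^ (j - 1)) *
          recFam m G (k + 1 - j)) + G k := by
  conv_lhs => rw [recFam, Nat.strongRecOn_eq]
  rw [← Finset.sum_attach ((Finset.range (k + 2)).filter (fun j => Odd j ∧ 3 ≤ j))]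
  rfl

theorem oddConv_recFam {m ρ ω : ℝ} (hω : ω = m * ρ) (x : ℝ) (G : ℕ → Polynomial ℝ) (k : ℕ) :
    oddConv ω (fun i => ρ ^ (i + 1) * (recFam m G i).eval x) (k + 1) =
      ω * ((k + 1) * ρ ^ (k + 1) * (G k).eval x) := by
  subst hω
  have hk : (k + 1 : ℝ) ≠ 0 := by positivity
  have hrec : (k + 1) * (recFam m G k).eval x =
      ∑ j ∈ (Finset.range (k + 2)).filter (fun j => Odd j ∧ 3 ≤ j),
        (-1 : ℝ) ^ ((j + 1) / 2) * ((k + 1).choose j : ℝ) * m ^ (j - 1) *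
          (recFam m G (k + 1 - j)).eval x + (k + 1) * (G k).eval x := by
    rw [recFam_eq]
    simp only [Polynomial.eval_add, Polynomial.eval_mul, Polynomial.eval_C,
      Polynomial.eval_finsetSum]
    field_simp
  rw [oddConv_succ]
  have hsum : ∑ j ∈ (Finset.range (k + 2)).filter (fun j => Odd j ∧ 3 ≤ j),
        (-1 : ℝ) ^ ((j - 1) / 2) * ((k + 1).choose j : ℝ) * (m * ρ) ^ j *
          (ρ ^ (k + 1 - j + 1) * (recFam m G (k + 1 - j)).eval x) =
      -(m * ρ ^ (k + 2) * ∑ j ∈ (Finset.range (k + 2)).filter (fun j => Odd j ∧ 3 ≤ j),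
        (-1 : ℝ) ^ ((j + 1) / 2) * ((k + 1).choose j : ℝ) * m ^ (j - 1) *
          (recFam m G (k + 1 - j)).eval x) := by
    rw [Finset.mul_sum, ← Finset.sum_neg_distrib]
    refine Finset.sum_congr rfl fun j hj => ?_
    simp only [Finset.mem_filter, Finset.mem_range] at hj
    obtain ⟨hjk, ⟨i, rfl⟩, -⟩ := hj
    obtain ⟨l, rfl⟩ : ∃ l, k = l + 2 * i := ⟨k - 2 * i, by omega⟩
    rw [show (2 * i + 1 - 1) / 2 = i by omega, show (2 * i + 1 + 1) / 2 = i + 1 by omega,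
      show l + 2 * i + 1 - (2 * i + 1) = l by omega, Nat.add_sub_cancel]
    ring
  rw [hsum]
  linear_combination m * ρ ^ (k + 2) * hrec

theorem eval_GR {ρ : ℝ} (hρ : ρ ≠ 0) (L : ℝ) (k : ℕ) :
    (k + 1) * ρ ^ (k + 1) * (GR k).eval (L / ρ) =
      (evenConv (2 * ρ) (fun i => L ^ i) (k + 1) + evenConv ρ (fun i => L ^ i) (k + 1)) / 2 := by
  have hk : (k + 1 : ℝ) ≠ 0 := by positivity
  simp only [GR, evenConv, Polynomial.eval_mul, Polynomial.eval_C, Polynomial.eval_finsetSum,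
    Polynomial.eval_pow, Polynomial.eval_X]
  rw [← Finset.sum_add_distrib, Finset.sum_div, Finset.mul_sum, Finset.mul_sum]
  refine Finset.sum_congr rfl fun j hj => ?_
  obtain ⟨l, hl⟩ : ∃ l, k + 1 = l + j := ⟨k + 1 - j, by simp at hj; omega⟩
  rw [hl, Nat.add_sub_cancel, div_pow, pow_add]
  field_simp
  ring

theorem eval_GP {ρ : ℝ} (hρ : ρ ≠ 0) (L : ℝ) (k : ℕ) :
    (k + 1) * ρ ^ (k + 1) * (GP k).eval (L / ρ) =
      (evenConv (5 * ρ) (fun i => L ^ i) (k + 1) + evenConv ρ (fun i => L ^ i) (k + 1)) / 2 := by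
  have hk : (k + 1 : ℝ) ≠ 0 := by positivity
  simp only [GP, evenConv, Polynomial.eval_mul, Polynomial.eval_C, Polynomial.eval_finsetSum,
    Polynomial.eval_pow, Polynomial.eval_X]
  rw [← Finset.sum_add_distrib, Finset.sum_div, Finset.mul_sum, Finset.mul_sum]
  refine Finset.sum_congr rfl fun j hj => ?_
  obtain ⟨l, hl⟩ : ∃ l, k + 1 = l + j := ⟨k + 1 - j, by simp at hj; omega⟩
  rw [hl, Nat.add_sub_cancel, div_pow, pow_add]
  field_simp
  ring

theorem eval_GS {ρ : ℝ} (hρ : ρ ≠ 0) (L : ℝ) (k : ℕ) :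
    (k + 1) * ρ ^ (k + 1) * (GS k).eval (L / ρ) =
      (oddConv ρ (fun i => L ^ i) (k + 1) - oddConv (2 * ρ) (fun i => L ^ i) (k + 1)) / 2 := by
  have hk : (k + 1 : ℝ) ≠ 0 := by positivity
  simp only [GS, oddConv, Polynomial.eval_mul, Polynomial.eval_C, Polynomial.eval_finsetSum,
    Polynomial.eval_pow, Polynomial.eval_X]
  rw [← Finset.sum_sub_distrib, Finset.sum_div, Finset.mul_sum, Finset.mul_sum]
  refine Finset.sum_congr rfl fun j hj => ?_
  obtain ⟨l, hl⟩ : ∃ l, k + 1 = l + j := ⟨k + 1 - j, by simp at hj; omega⟩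
  have hsign : (-1 : ℝ) ^ ((j + 1) / 2) = -(-1) ^ ((j - 1) / 2) := by
    obtain ⟨i, rfl⟩ := (Finset.mem_filter.1 hj).2
    rw [show (2 * i + 1 + 1) / 2 = i + 1 by omega, show (2 * i + 1 - 1) / 2 = i by omega]
    ring
  rw [hsign, hl, Nat.add_sub_cancel, div_pow, pow_add]
  field_simp
  ring

theorem eval_GQ {ρ : ℝ} (hρ : ρ ≠ 0) (L : ℝ) (k : ℕ) :
    (k + 1) * ρ ^ (k + 1) * (GQ k).eval (L / ρ) =
      (oddConv (5 * ρ) (fun i => L ^ i) (k + 1) - oddConv ρ (fun i => L ^ i) (k + 1)) / 2 := by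
  have hk : (k + 1 : ℝ) ≠ 0 := by positivity
  simp only [GQ, oddConv, Polynomial.eval_mul, Polynomial.eval_C, Polynomial.eval_finsetSum,
    Polynomial.eval_pow, Polynomial.eval_X]
  rw [← Finset.sum_sub_distrib, Finset.sum_div, Finset.mul_sum, Finset.mul_sum]
  refine Finset.sum_congr rfl fun j hj => ?_
  obtain ⟨l, hl⟩ : ∃ l, k + 1 = l + j := ⟨k + 1 - j, by simp at hj; omega⟩
  rw [hl, Nat.add_sub_cancel, div_pow, pow_add]
  field_simp
  ring

theorem iteratedDeriv_sin_mul_exp_zero (ω L : ℝ) (n : ℕ) :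
    iteratedDeriv n (fun s => Real.sin (ω * s) * Real.exp (L * s)) 0 =
      oddConv ω (fun i => L ^ i) n := by
  simp [iteratedDeriv_sin_mul_zero ω (f := fun s => Real.exp (L * s)) n (by fun_prop),
    iteratedDeriv_exp_const_mul]

theorem iteratedDeriv_cos_mul_exp_zero (ω L : ℝ) (n : ℕ) :
    iteratedDeriv n (fun s => Real.cos (ω * s) * Real.exp (L * s)) 0 =
      evenConv ω (fun i => L ^ i) n := by
  simp [iteratedDeriv_cos_mul_zero ω (f := fun s => Real.exp (L * s)) n (by fun_prop),
    iteratedDeriv_exp_const_mul]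

/-- `sin (2 π s)` times the exponential generating function of the rescaled `Rpoly`. -/
noncomputable def Rgen (L s : ℝ) : ℝ :=
  Real.pi * (Real.cos (2 * (2 * Real.pi / 3) * s) *
    Real.exp (L * s) + Real.cos (2 * Real.pi / 3 * s) * Real.exp (L * s))

theorem analyticAt_Rgen (L s : ℝ) : AnalyticAt ℝ (Rgen L) s := by
  unfold Rgen
  fun_prop

theorem oddConv_Rpoly (L : ℝ) (k : ℕ) :
    oddConv (2 * Real.pi)
        (fun i => (2 * Real.pi / 3) ^ (i + 1) * (Rpoly i).eval (L / (2 * Real.pi / 3))) (k + 1) =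
      iteratedDeriv (k + 1) (Rgen L) 0 := by
  unfold Rgen
  rw [iteratedDeriv_const_mul_field, iteratedDeriv_fun_add (by fun_prop) (by fun_prop),
    iteratedDeriv_cos_mul_exp_zero, iteratedDeriv_cos_mul_exp_zero,
    Rpoly, oddConv_recFam (by ring), eval_GR (by positivity)]
  ring

/-- `sin (2 π s)` times the exponential generating function of the rescaled `Spoly`. -/
noncomputable def Sgen (L s : ℝ) : ℝ :=
  Real.pi * (Real.sin (2 * Real.pi / 3 * s) *
    Real.exp (L * s) - Real.sin (2 * (2 * Real.pi / 3) * s) * Real.exp (L * s))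

theorem analyticAt_Sgen (L s : ℝ) : AnalyticAt ℝ (Sgen L) s := by
  unfold Sgen
  fun_prop

theorem oddConv_Spoly (L : ℝ) (k : ℕ) :
    oddConv (2 * Real.pi)
        (fun i => (2 * Real.pi / 3) ^ (i + 1) * (Spoly i).eval (L / (2 * Real.pi / 3))) (k + 1) =
      iteratedDeriv (k + 1) (Sgen L) 0 := by
  unfold Sgen
  rw [iteratedDeriv_const_mul_field, iteratedDeriv_fun_sub (by fun_prop) (by fun_prop),
    iteratedDeriv_sin_mul_exp_zero, iteratedDeriv_sin_mul_exp_zero,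
    Spoly, oddConv_recFam (by ring), eval_GS (by positivity)]
  ring

/-- `sin (2 π s)` times the exponential generating function of the rescaled `Ppoly`. -/
noncomputable def Pgen (L s : ℝ) : ℝ :=
  Real.pi * (Real.cos (5 * (Real.pi / 3) * s) *
    Real.exp (L * s) + Real.cos (Real.pi / 3 * s) * Real.exp (L * s))

theorem analyticAt_Pgen (L s : ℝ) : AnalyticAt ℝ (Pgen L) s := by
  unfold Pgen
  fun_prop

theorem oddConv_Ppoly (L : ℝ) (k : ℕ) :
    oddConv (2 * Real.pi)
        (fun i => (Real.pi / 3) ^ (i + 1) * (Ppoly i).eval (L / (Real.pi / 3))) (k + 1) =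
      iteratedDeriv (k + 1) (Pgen L) 0 := by
  unfold Pgen
  rw [iteratedDeriv_const_mul_field, iteratedDeriv_fun_add (by fun_prop) (by fun_prop),
    iteratedDeriv_cos_mul_exp_zero, iteratedDeriv_cos_mul_exp_zero,
    Ppoly, oddConv_recFam (by ring), eval_GP (by positivity)]
  ring

/-- `sin (2 π s)` times the exponential generating function of the rescaled `Qpoly`. -/
noncomputable def Qgen (L s : ℝ) : ℝ :=
  Real.pi * (Real.sin (5 * (Real.pi / 3) * s) *
    Real.exp (L * s) - Real.sin (Real.pi / 3 * s) * Real.exp (L * s))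

theorem analyticAt_Qgen (L s : ℝ) : AnalyticAt ℝ (Qgen L) s := by
  unfold Qgen
  fun_prop

theorem oddConv_Qpoly (L : ℝ) (k : ℕ) :
    oddConv (2 * Real.pi)
        (fun i => (Real.pi / 3) ^ (i + 1) * (Qpoly i).eval (L / (Real.pi / 3))) (k + 1) =
      iteratedDeriv (k + 1) (Qgen L) 0 := by
  unfold Qgen
  rw [iteratedDeriv_const_mul_field, iteratedDeriv_fun_sub (by fun_prop) (by fun_prop),
    iteratedDeriv_sin_mul_exp_zero, iteratedDeriv_sin_mul_exp_zero,
    Qpoly, oddConv_recFam (by ring), eval_GQ (by positivity)]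
  ring

/-- The measure on `(0, ∞)` with density `t * quarticWeight a b t`. -/
noncomputable def quarticMeasure (a b : ℝ) : Measure ℝ :=
  (volume.restrict (Set.Ioi 0)).withDensity fun t => ENNReal.ofReal (t * quarticWeight a b t)

theorem measurable_ofReal_mul_quarticWeight (a b : ℝ) :
    Measurable fun t => ENNReal.ofReal (t * quarticWeight a b t) := by
  unfold quarticWeight
  fun_prop

theorem integral_quarticMeasure {a b : ℝ} (ha : a ≠ 0) (hb : b ≠ 0) (f : ℝ → ℝ) :
    ∫ t, f t ∂quarticMeasure a b = ∫ t in Set.Ioi (0 : ℝ), f t * (t * quarticWeight a b t) := by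
  rw [quarticMeasure,
    integral_withDensity_eq_integral_toReal_smul (measurable_ofReal_mul_quarticWeight a b)
      (by simp)]
  refine setIntegral_congr_fun measurableSet_Ioi fun t ht => ?_
  have ht' := mul_nonneg (le_of_lt ht) (quarticWeight_nonneg ha hb t)
  simp only [ENNReal.toReal_ofReal ht', smul_eq_mul]
  ring

theorem mgf_log_quarticMeasure {a b : ℝ} (ha : a ≠ 0) (hb : b ≠ 0) (s : ℝ) :
    ProbabilityTheory.mgf Real.log (quarticMeasure a b) s =
      ∫ t in Set.Ioi (0 : ℝ), t ^ s * (t * quarticWeight a b t) := by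
  rw [ProbabilityTheory.mgf, integral_quarticMeasure ha hb]
  refine setIntegral_congr_fun measurableSet_Ioi fun t ht => ?_
  simp only [Real.rpow_def_of_pos ht, mul_comm s]

theorem zero_mem_interior_integrableExpSet_log {a b : ℝ} (ha : a ≠ 0) (hb : b ≠ 0) :
    0 ∈ interior (ProbabilityTheory.integrableExpSet Real.log (quarticMeasure a b)) := by
  refine interior_maximal (t := Set.Ioo (-1) 1) (fun s hs => ?_) isOpen_Ioo (by simp)
  rw [ProbabilityTheory.integrableExpSet, Set.mem_ofPred_eq, quarticMeasure,
    integrable_withDensity_iff_integrable_smul' (measurable_ofReal_mul_quarticWeight a b) (by simp)]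
  refine IntegrableOn.congr_fun (integrableOn_rpow_mul_quarticWeight ha hb hs.1 hs.2)
    (fun t ht => ?_) measurableSet_Ioi
  have ht' := mul_nonneg (le_of_lt ht) (quarticWeight_nonneg ha hb t)
  simp only [ENNReal.toReal_ofReal ht', smul_eq_mul, Real.rpow_def_of_pos ht, mul_comm s]
  ring

theorem sin_two_pi_mul_mgf {a b : ℝ} (ha : a ≠ 0) (hb : b ≠ 0) (hab : a ^ 3 ≠ b ^ 3) {s : ℝ}
    (hs : -1 < s) (hs0 : s < 0) :
    Real.sin (2 * Real.pi * s) * ProbabilityTheory.mgf Real.log (quarticMeasure a b) s =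
      4 * Real.pi * Real.cos (Real.pi * s / 2) * Real.cos (Real.pi * s) *
        ((a + b) / (a ^ 3 - b ^ 3) * (Real.cos (Real.pi * s / 6) *
            (Real.exp (Real.log |a| * s) - Real.exp (Real.log |b| * s)))
          + 1 / (√3 * (a ^ 2 + a * b + b ^ 2)) * (Real.sin (Real.pi * s / 6) *
            (Real.exp (Real.log |a| * s) + Real.exp (Real.log |b| * s)))) := by
  have hsin : Real.sin (Real.pi * s / 2) ≠ 0 := by
    have hpi := Real.pi_pos
    exact (Real.sin_neg_of_neg_of_neg_pi_lt (by nlinarith) (by nlinarith)).ne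
  rw [mgf_log_quarticMeasure ha hb, integral_rpow_mul_quarticWeight ha hb hab (by linarith) hs0,
    show 2 * Real.pi * s = 2 * (Real.pi * s) by ring, Real.sin_two_mul,
    show Real.sin (Real.pi * s) = Real.sin (2 * (Real.pi * s / 2)) by ring_nf, Real.sin_two_mul]
  generalize Real.sin (Real.pi * s / 2) = σ at *
  rw [show ∀ x y z w : ℝ, 2 * (2 * σ * x) * y * (z / σ * w) = 4 * z * x * y * w from
    fun x y z w => by field_simp; ring]

theorem four_mul_cos_mul_cos_mul_cos (x : ℝ) :
    4 * Real.cos (3 * x) * Real.cos (6 * x) * Real.cos x =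
      Real.cos (8 * x) + Real.cos (4 * x) + (Real.cos (10 * x) + Real.cos (2 * x)) := by
  have h1 := Real.two_mul_cos_mul_cos (3 * x) x
  have h2 := Real.two_mul_cos_mul_cos (6 * x) (2 * x)
  have h3 := Real.two_mul_cos_mul_cos (6 * x) (4 * x)
  ring_nf at h1 h2 h3 ⊢
  linear_combination 2 * Real.cos (x * 6) * h1 + h2 + h3

theorem four_mul_cos_mul_cos_mul_sin (x : ℝ) :
    4 * Real.cos (3 * x) * Real.cos (6 * x) * Real.sin x =
      Real.sin (4 * x) - Real.sin (8 * x) + (Real.sin (10 * x) - Real.sin (2 * x)) := by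
  have h1 := Real.two_mul_sin_mul_cos x (3 * x)
  have h2 := Real.two_mul_sin_mul_cos (2 * x) (6 * x)
  have h3 := Real.two_mul_sin_mul_cos (4 * x) (6 * x)
  ring_nf at h1 h2 h3 ⊢
  simp only [Real.sin_neg] at h1 h2 h3
  linear_combination 2 * Real.cos (x * 6) * h1 - h2 + h3

theorem sin_mul_mgf_eventuallyEq {a b : ℝ} (ha : a ≠ 0) (hb : b ≠ 0) (hab : a ^ 3 ≠ b ^ 3) :
    (fun s => Real.sin (2 * Real.pi * s) *
        ProbabilityTheory.mgf Real.log (quarticMeasure a b) s) =ᶠ[nhds 0]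
      fun s => (a + b) / (a ^ 3 - b ^ 3) * (Rgen (Real.log |a|) s - Rgen (Real.log |b|) s)
        + 1 / (√3 * (a ^ 2 + a * b + b ^ 2)) * (Sgen (Real.log |a|) s + Sgen (Real.log |b|) s)
        + (a + b) / (a ^ 3 - b ^ 3) * (Pgen (Real.log |a|) s - Pgen (Real.log |b|) s)
        + 1 / (√3 * (a ^ 2 + a * b + b ^ 2)) *
          (Qgen (Real.log |a|) s + Qgen (Real.log |b|) s) := by
  have hM := ProbabilityTheory.analyticAt_mgf (zero_mem_interior_integrableExpSet_log ha hb)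
  have hR := analyticAt_Rgen
  have hS := analyticAt_Sgen
  have hP := analyticAt_Pgen
  have hQ := analyticAt_Qgen
  refine (AnalyticAt.frequently_eq_iff_eventually_eq (by fun_prop) (by fun_prop)).1 ?_
  have hle : nhdsWithin (0 : ℝ) (Set.Iio 0) ≤ nhdsWithin 0 {0}ᶜ :=
    nhdsWithin_mono _ fun s hs => ne_of_lt hs
  refine Filter.Frequently.filter_mono (Filter.Eventually.frequently ?_) hle
  filter_upwards [Ioo_mem_nhdsLT (show (-1 : ℝ) < 0 by norm_num)] with s hs
  rw [sin_two_pi_mul_mgf ha hb hab hs.1 hs.2]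
  have hcos := four_mul_cos_mul_cos_mul_cos (Real.pi * s / 6)
  have hsin := four_mul_cos_mul_cos_mul_sin (Real.pi * s / 6)
  simp only [Rgen, Sgen, Pgen, Qgen]
  rw [show 3 * (Real.pi * s / 6) = Real.pi * s / 2 by ring,
    show 6 * (Real.pi * s / 6) = Real.pi * s by ring,
    show 8 * (Real.pi * s / 6) = 2 * (2 * Real.pi / 3) * s by ring,
    show 4 * (Real.pi * s / 6) = 2 * Real.pi / 3 * s by ring,
    show 10 * (Real.pi * s / 6) = 5 * (Real.pi / 3) * s by ring,
    show 2 * (Real.pi * s / 6) = Real.pi / 3 * s by ring] at hcos hsin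
  linear_combination
    Real.pi * ((a + b) / (a ^ 3 - b ^ 3)) *
      (Real.exp (Real.log |a| * s) - Real.exp (Real.log |b| * s)) * hcos +
    Real.pi * (1 / (√3 * (a ^ 2 + a * b + b ^ 2))) *
      (Real.exp (Real.log |a| * s) + Real.exp (Real.log |b| * s)) * hsin

theorem iteratedDeriv_mgf_log_quarticMeasure {a b : ℝ} (ha : a ≠ 0) (hb : b ≠ 0)
    (hab : a ^ 3 ≠ b ^ 3) (k : ℕ) :
    iteratedDeriv k (ProbabilityTheory.mgf Real.log (quarticMeasure a b)) 0 =
      (a + b) / (a ^ 3 - b ^ 3) *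
          ((2 * Real.pi / 3) ^ (k + 1) * (Rpoly k).eval (Real.log |a| / (2 * Real.pi / 3))
            - (2 * Real.pi / 3) ^ (k + 1) * (Rpoly k).eval (Real.log |b| / (2 * Real.pi / 3)))
        + 1 / (√3 * (a ^ 2 + a * b + b ^ 2)) *
          ((2 * Real.pi / 3) ^ (k + 1) * (Spoly k).eval (Real.log |a| / (2 * Real.pi / 3))
            + (2 * Real.pi / 3) ^ (k + 1) * (Spoly k).eval (Real.log |b| / (2 * Real.pi / 3)))
        + (a + b) / (a ^ 3 - b ^ 3) *
          ((Real.pi / 3) ^ (k + 1) * (Ppoly k).eval (Real.log |a| / (Real.pi / 3))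
            - (Real.pi / 3) ^ (k + 1) * (Ppoly k).eval (Real.log |b| / (Real.pi / 3)))
        + 1 / (√3 * (a ^ 2 + a * b + b ^ 2)) *
          ((Real.pi / 3) ^ (k + 1) * (Qpoly k).eval (Real.log |a| / (Real.pi / 3))
            + (Real.pi / 3) ^ (k + 1) * (Qpoly k).eval (Real.log |b| / (Real.pi / 3))) := by
  revert k
  refine oddConv_injective (ω := 2 * Real.pi) (by positivity) fun k => ?_
  have hM := ProbabilityTheory.analyticAt_mgf (zero_mem_interior_integrableExpSet_log ha hb)
  have hR (L : ℝ) : ContDiffAt ℝ (k + 1 : ℕ) (Rgen L) 0 := (analyticAt_Rgen L 0).contDiffAt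
  have hS (L : ℝ) : ContDiffAt ℝ (k + 1 : ℕ) (Sgen L) 0 := (analyticAt_Sgen L 0).contDiffAt
  have hP (L : ℝ) : ContDiffAt ℝ (k + 1 : ℕ) (Pgen L) 0 := (analyticAt_Pgen L 0).contDiffAt
  have hQ (L : ℝ) : ContDiffAt ℝ (k + 1 : ℕ) (Qgen L) 0 := (analyticAt_Qgen L 0).contDiffAt
  rw [← iteratedDeriv_sin_mul_zero _ _ hM.contDiffAt,
    (sin_mul_mgf_eventuallyEq ha hb hab).iteratedDeriv_eq]
  simp (discharger := fun_prop) only [iteratedDeriv_fun_add, iteratedDeriv_fun_sub,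
    iteratedDeriv_const_mul_field, oddConv_add, oddConv_sub, oddConv_const_mul, oddConv_Rpoly,
    oddConv_Spoly, oddConv_Ppoly, oddConv_Qpoly]

/-- `f₁(k) + f₂(k)` for nonzero real `a`, `b` with `a³ ≠ b³`, in terms of the recursive
polynomials `R_k`, `S_k`, `P_k`, `Q_k`, with `θ = 2π/3` and `δ = π/3`. -/
theorem f1_add_f2_eval (a b : ℝ) (ha : a ≠ 0) (hb : b ≠ 0) (hab : a ^ 3 ≠ b ^ 3) (k : ℕ) :
    ∫ t in Set.Ioi (0 : ℝ),
        t * Real.log t ^ k *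
          (1 / ((t ^ 2 + a * t + a ^ 2) * (t ^ 2 + b * t + b ^ 2))
            + 1 / ((t ^ 2 - a * t + a ^ 2) * (t ^ 2 - b * t + b ^ 2))) =
      (2 * Real.pi / 3) ^ (k + 1) * (a + b) / (a ^ 3 - b ^ 3) *
          ((Rpoly k).eval (Real.log |a| / (2 * Real.pi / 3))
            - (Rpoly k).eval (Real.log |b| / (2 * Real.pi / 3)))
        + (2 * Real.pi / 3) ^ (k + 1) / (Real.sqrt 3 * (a ^ 2 + a * b + b ^ 2)) *
          ((Spoly k).eval (Real.log |a| / (2 * Real.pi / 3))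
            + (Spoly k).eval (Real.log |b| / (2 * Real.pi / 3)))
        + (Real.pi / 3) ^ (k + 1) * (a + b) / (a ^ 3 - b ^ 3) *
          ((Ppoly k).eval (Real.log |a| / (Real.pi / 3))
            - (Ppoly k).eval (Real.log |b| / (Real.pi / 3)))
        + (Real.pi / 3) ^ (k + 1) / (Real.sqrt 3 * (a ^ 2 + a * b + b ^ 2)) *
          ((Qpoly k).eval (Real.log |a| / (Real.pi / 3))
            + (Qpoly k).eval (Real.log |b| / (Real.pi / 3))) := by
  calc _ = ∫ t, Real.log t ^ k ∂quarticMeasure a b := by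
        rw [integral_quarticMeasure ha hb]
        refine setIntegral_congr_fun measurableSet_Ioi fun t _ => ?_
        simp only [quarticWeight]
        ring
    _ = iteratedDeriv k (ProbabilityTheory.mgf Real.log (quarticMeasure a b)) 0 :=
        (ProbabilityTheory.iteratedDeriv_mgf_zero
          (zero_mem_interior_integrableExpSet_log ha hb) k).symm
    _ = _ := by
        rw [iteratedDeriv_mgf_log_quarticMeasure ha hb hab]
        ring
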